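/- Let π_n, π_{n+1}, η_n be policies with E_{s∼d_{π_n}}[D_TV(π_{n+1}(·|s), π_n(·|s))] ≤ β for some β ≥ 0. Define ε = max_{s∈S} |E_{a∼π_{n+1}(·|s)}[A^{η_n}(s,a)]| and 𝔸_n(π_{n+1}) = E_{s∼d_{π_n}}[E_{a∼π_{n+1}(·|s)}[A^{η_n}(s,a)]]. Then (1−γ)·(J(π_{n+1}) − J(η_n)) ≤ 2εβ/(1−γ) + 𝔸_n(π_{n+1}). -/

import Mathlib

open scoped BigOperators

noncomputable section

/-- `p` is a probability distribution on a finite type. -/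
def IsDist {X : Type*} [Fintype X] (p : X → ℝ) : Prop :=
  (∀ x, 0 ≤ p x) ∧ ∑ x, p x = 1

/-- `P` is a transition dynamics: `P s a` is a distribution over next states. -/
def IsDynamics {S A : Type*} [Fintype S] (P : S → A → S → ℝ) : Prop :=
  ∀ s a, IsDist (P s a)

/-- `π` is a (stochastic) policy: `π s` is a distribution over actions. -/
def IsPolicy {S A : Type*} [Fintype A] (π : S → A → ℝ) : Prop :=
  ∀ s, IsDist (π s)

/-- One-step evolution of a state distribution under policy `π` and dynamics `P`. -/
def step {S A : Type*} [Fintype S] [Fintype A]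
    (P : S → A → S → ℝ) (π : S → A → ℝ) (d : S → ℝ) : S → ℝ :=
  fun s' => ∑ s, ∑ a, d s * π s a * P s a s'

/-- The time-`t` state distribution `d_π^t` starting from `ρ₀`. -/
def stateDist {S A : Type*} [Fintype S] [Fintype A]
    (P : S → A → S → ℝ) (π : S → A → ℝ) (ρ₀ : S → ℝ) : ℕ → S → ℝ
  | 0 => ρ₀
  | t + 1 => step P π (stateDist P π ρ₀ t)

/-- Discounted state visitation distribution `d_π = (1-γ) Σ_t γ^t d_π^t`. -/
def visit {S A : Type*} [Fintype S] [Fintype A]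
    (γ : ℝ) (P : S → A → S → ℝ) (π : S → A → ℝ) (ρ₀ : S → ℝ) : S → ℝ :=
  fun s => (1 - γ) * ∑' t : ℕ, γ ^ t * stateDist P π ρ₀ t s

/-- Expected cost of one step when the state is distributed as `d` and actions follow `π`. -/
def expCost {S A : Type*} [Fintype S] [Fintype A]
    (c : S → A → ℝ) (π : S → A → ℝ) (d : S → ℝ) : ℝ :=
  ∑ s, ∑ a, d s * π s a * c s a

/-- Value function `V^π(s₀)`: expected total discounted cost starting at `s₀`. -/
def Vf {S A : Type*} [Fintype S] [Fintype A] [DecidableEq S]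
    (γ : ℝ) (P : S → A → S → ℝ) (c : S → A → ℝ) (π : S → A → ℝ) (s₀ : S) : ℝ :=
  ∑' t : ℕ, γ ^ t * expCost c π (stateDist P π (fun s => if s = s₀ then 1 else 0) t)

/-- Objective `J(π) = E_{s∼ρ₀}[V^π(s)]`. -/
def Jf {S A : Type*} [Fintype S] [Fintype A] [DecidableEq S]
    (γ : ℝ) (P : S → A → S → ℝ) (c : S → A → ℝ) (ρ₀ : S → ℝ) (π : S → A → ℝ) : ℝ :=
  ∑ s, ρ₀ s * Vf γ P c π s

/-- State-action value `Q^π(s,a) = c(s,a) + γ E_{s'∼P_{s,a}}[V^π(s')]`. -/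
def Qf {S A : Type*} [Fintype S] [Fintype A] [DecidableEq S]
    (γ : ℝ) (P : S → A → S → ℝ) (c : S → A → ℝ) (π : S → A → ℝ) (s : S) (a : A) : ℝ :=
  c s a + γ * ∑ s', P s a s' * Vf γ P c π s'

/-- Disadvantage function `A^π(s,a) = Q^π(s,a) - V^π(s)`. -/
def Adv {S A : Type*} [Fintype S] [Fintype A] [DecidableEq S]
    (γ : ℝ) (P : S → A → S → ℝ) (c : S → A → ℝ) (π : S → A → ℝ) (s : S) (a : A) : ℝ :=
  Qf γ P c π s a - Vf γ P c π s

section Helpers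

variable {S A : Type*} [Fintype S] [Fintype A]

lemma IsDist.step {P : S → A → S → ℝ} {π : S → A → ℝ} {d : S → ℝ}
    (hP : IsDynamics P) (hπ : IsPolicy π) (hd : IsDist d) : IsDist (step P π d) := by
  refine ⟨fun s' => Finset.sum_nonneg fun s _ => Finset.sum_nonneg fun a _ =>
    mul_nonneg (mul_nonneg (hd.1 s) ((hπ s).1 a)) ((hP s a).1 s'), ?_⟩
  simp only [_root_.step]
  rw [Finset.sum_comm]
  have h : ∀ s, ∑ s', ∑ a, d s * π s a * P s a s' = d s := fun s => by
    rw [Finset.sum_comm]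
    simp_rw [← Finset.mul_sum, (hP s _).2, mul_one]
    rw [← Finset.mul_sum, (hπ s).2, mul_one]
  simp_rw [h, hd.2]

lemma IsDist.stateDist {P : S → A → S → ℝ} {π : S → A → ℝ} {ρ : S → ℝ}
    (hP : IsDynamics P) (hπ : IsPolicy π) (hρ : IsDist ρ) (t : ℕ) :
    IsDist (stateDist P π ρ t) := by
  induction t with
  | zero => exact hρ
  | succ t ih => exact ih.step hP hπ

lemma IsDist.le_one {d : S → ℝ} (hd : IsDist d) (s : S) : d s ≤ 1 :=
  hd.2 ▸ Finset.single_le_sum (fun x _ => hd.1 x) (Finset.mem_univ s)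

lemma isDist_dirac [DecidableEq S] (s₀ : S) :
    IsDist (fun s : S => if s = s₀ then (1 : ℝ) else 0) :=
  ⟨fun s => by dsimp only; split_ifs <;> norm_num, by simp⟩

lemma summable_discounted_stateDist {γ : ℝ} (hγ : 0 < γ) (hγ' : γ < 1)
    {P : S → A → S → ℝ} {π : S → A → ℝ} {ρ : S → ℝ}
    (hP : IsDynamics P) (hπ : IsPolicy π) (hρ : IsDist ρ) (s : S) :
    Summable fun t : ℕ => γ ^ t * stateDist P π ρ t s := by
  refine Summable.of_nonneg_of_le (fun t => ?_) (fun t => ?_)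
    (summable_geometric_of_lt_one hγ.le hγ')
  · exact mul_nonneg (by positivity) ((hρ.stateDist hP hπ t).1 s)
  · exact mul_le_of_le_one_right (by positivity) ((hρ.stateDist hP hπ t).le_one s)

lemma visit_nonneg {γ : ℝ} (hγ : 0 < γ) (hγ' : γ < 1)
    {P : S → A → S → ℝ} {π : S → A → ℝ} {ρ : S → ℝ}
    (hP : IsDynamics P) (hπ : IsPolicy π) (hρ : IsDist ρ) (s : S) :
    0 ≤ visit γ P π ρ s :=
  mul_nonneg (by linarith) (tsum_nonneg fun t =>
    mul_nonneg (by positivity) ((hρ.stateDist hP hπ t).1 s))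

lemma hasSum_sum_mul_mul {f : ℕ → S → ℝ} (hf : ∀ s, Summable fun t => f t s)
    (π w : S → A → ℝ) :
    HasSum (fun t => ∑ s, ∑ a, f t s * π s a * w s a)
      (∑ s, ∑ a, (∑' t, f t s) * π s a * w s a) :=
  hasSum_sum fun s _ => hasSum_sum fun a _ =>
    ((hf s).hasSum.mul_right (π s a)).mul_right (w s a)

/-- The visitation distribution satisfies the discounted flow equation. -/
lemma visit_eq {γ : ℝ} (hγ : 0 < γ) (hγ' : γ < 1)
    {P : S → A → S → ℝ} {π : S → A → ℝ} {ρ : S → ℝ}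
    (hP : IsDynamics P) (hπ : IsPolicy π) (hρ : IsDist ρ) (s' : S) :
    visit γ P π ρ s' = (1 - γ) * ρ s' + γ * step P π (visit γ P π ρ) s' := by
  have hs := summable_discounted_stateDist hγ hγ' hP hπ hρ
  have h : HasSum (fun t : ℕ => γ ^ (t + 1) * stateDist P π ρ (t + 1) s')
      (γ * ∑ s, ∑ a, (∑' t : ℕ, γ ^ t * stateDist P π ρ t s) * π s a * P s a s') := by
    refine ((hasSum_sum_mul_mul hs π fun s a => P s a s').mul_left γ).congr_fun fun t => ?_
    simp only [_root_.stateDist, _root_.step, Finset.mul_sum]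
    refine Finset.sum_congr rfl fun s _ => Finset.sum_congr rfl fun a _ => ?_
    ring
  have h0 := (hs s').tsum_eq_zero_add
  rw [h.tsum_eq] at h0
  simp only [visit, _root_.step]
  rw [h0]
  simp only [pow_zero, one_mul, _root_.stateDist, mul_add, Finset.mul_sum]
  congr 1
  refine Finset.sum_congr rfl fun s _ => Finset.sum_congr rfl fun a _ => ?_
  ring

lemma stateDist_eq_sum_dirac [DecidableEq S] (P : S → A → S → ℝ) (π : S → A → ℝ)
    (ρ : S → ℝ) (t : ℕ) (s' : S) :
    stateDist P π ρ t s' =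
      ∑ s₀, ρ s₀ * stateDist P π (fun s => if s = s₀ then 1 else 0) t s' := by
  induction t generalizing s' with
  | zero => simp [stateDist]
  | succ t ih =>
    simp only [stateDist, step, Finset.mul_sum]
    symm
    rw [Finset.sum_comm]
    refine Finset.sum_congr rfl fun s _ => ?_
    rw [Finset.sum_comm]
    refine Finset.sum_congr rfl fun a _ => ?_
    rw [ih, Finset.sum_mul, Finset.sum_mul]
    exact Finset.sum_congr rfl fun _ _ => by ring

lemma hasSum_expCost {γ : ℝ} (hγ : 0 < γ) (hγ' : γ < 1)
    {P : S → A → S → ℝ} {π : S → A → ℝ} {ρ : S → ℝ}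
    (hP : IsDynamics P) (hπ : IsPolicy π) (hρ : IsDist ρ) (c : S → A → ℝ) :
    HasSum (fun t : ℕ => γ ^ t * expCost c π (stateDist P π ρ t))
      (expCost c π fun s => ∑' t : ℕ, γ ^ t * stateDist P π ρ t s) := by
  refine (hasSum_sum_mul_mul
    (summable_discounted_stateDist hγ hγ' hP hπ hρ) π c).congr_fun fun t => ?_
  simp only [expCost, Finset.mul_sum]
  exact Finset.sum_congr rfl fun s _ => Finset.sum_congr rfl fun a _ => by ring

lemma expCost_eq_sum_dirac [DecidableEq S] (P : S → A → S → ℝ) (π : S → A → ℝ)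
    (c : S → A → ℝ) (ρ : S → ℝ) (t : ℕ) :
    expCost c π (stateDist P π ρ t) =
      ∑ s₀, ρ s₀ * expCost c π (stateDist P π (fun s => if s = s₀ then 1 else 0) t) := by
  simp only [expCost, Finset.mul_sum]
  symm
  rw [Finset.sum_comm]
  refine Finset.sum_congr rfl fun s _ => ?_
  rw [Finset.sum_comm]
  refine Finset.sum_congr rfl fun a _ => ?_
  rw [stateDist_eq_sum_dirac P π ρ, Finset.sum_mul, Finset.sum_mul]
  exact Finset.sum_congr rfl fun _ _ => by ring

/-- The normalised objective is the expected cost under the visitation distribution. -/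
lemma one_sub_mul_Jf [DecidableEq S] {γ : ℝ} (hγ : 0 < γ) (hγ' : γ < 1)
    {P : S → A → S → ℝ} {π : S → A → ℝ} {ρ : S → ℝ}
    (hP : IsDynamics P) (hπ : IsPolicy π) (hρ : IsDist ρ) (c : S → A → ℝ) :
    (1 - γ) * Jf γ P c ρ π = expCost c π (visit γ P π ρ) := by
  have h1 : HasSum (fun t : ℕ => γ ^ t * expCost c π (stateDist P π ρ t))
      (Jf γ P c ρ π) := by
    have := hasSum_sum fun s₀ (_ : s₀ ∈ Finset.univ) =>
      ((hasSum_expCost hγ hγ' hP hπ (isDist_dirac s₀) c).summable.hasSum.mul_left (ρ s₀))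
    refine this.congr_fun fun t => ?_
    rw [expCost_eq_sum_dirac, Finset.mul_sum]
    exact Finset.sum_congr rfl fun _ _ => by ring
  rw [h1.unique (hasSum_expCost hγ hγ' hP hπ hρ c)]
  simp only [expCost, visit, Finset.mul_sum]
  exact Finset.sum_congr rfl fun s _ => Finset.sum_congr rfl fun a _ => by ring

lemma sum_step_mul (P : S → A → S → ℝ) (π : S → A → ℝ) (d f : S → ℝ) :
    ∑ s', step P π d s' * f s' = ∑ s, d s * ∑ a, π s a * ∑ s', P s a s' * f s' := by
  simp only [step, Finset.sum_mul, Finset.mul_sum]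
  rw [Finset.sum_comm]
  refine Finset.sum_congr rfl fun s _ => ?_
  rw [Finset.sum_comm]
  exact Finset.sum_congr rfl fun a _ => Finset.sum_congr rfl fun _ _ => by ring

/-- Performance difference lemma. -/
lemma performance_difference [DecidableEq S] {γ : ℝ} (hγ : 0 < γ) (hγ' : γ < 1)
    {P : S → A → S → ℝ} {π : S → A → ℝ} {ρ : S → ℝ}
    (hP : IsDynamics P) (hπ : IsPolicy π) (hρ : IsDist ρ) (c : S → A → ℝ) (η : S → A → ℝ) :
    (1 - γ) * (Jf γ P c ρ π - Jf γ P c ρ η) =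
      ∑ s, visit γ P π ρ s * ∑ a, π s a * Adv γ P c η s a := by
  have hadv : ∀ s, ∑ a, π s a * Adv γ P c η s a =
      ∑ a, π s a * c s a + γ * (∑ a, π s a * ∑ s', P s a s' * Vf γ P c η s')
        - Vf γ P c η s := fun s => by
    have : Vf γ P c η s = ∑ a, π s a * Vf γ P c η s := by
      rw [← Finset.sum_mul, (hπ s).2, one_mul]
    conv_rhs => rw [this]
    rw [Finset.mul_sum, ← Finset.sum_add_distrib, ← Finset.sum_sub_distrib]
    exact Finset.sum_congr rfl fun a _ => by simp only [Adv, Qf]; ring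
  have hflow : ∑ s, visit γ P π ρ s * Vf γ P c η s = (1 - γ) * Jf γ P c ρ η +
      γ * ∑ s, step P π (visit γ P π ρ) s * Vf γ P c η s := by
    rw [Jf, Finset.mul_sum, Finset.mul_sum, ← Finset.sum_add_distrib]
    refine Finset.sum_congr rfl fun s _ => ?_
    conv_lhs => rw [visit_eq hγ hγ' hP hπ hρ s]
    ring
  rw [sum_step_mul] at hflow
  have hcost : expCost c π (visit γ P π ρ) =
      ∑ s, visit γ P π ρ s * ∑ a, π s a * c s a := by
    simp only [expCost, Finset.mul_sum, mul_assoc]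
  simp_rw [hadv, mul_sub, mul_add]
  rw [Finset.sum_sub_distrib, Finset.sum_add_distrib, hflow, ← hcost,
    one_sub_mul_Jf hγ hγ' hP hπ hρ c, Finset.mul_sum]
  simp_rw [mul_left_comm γ]
  ring

lemma sum_abs_sum_mul_le {P : S → A → S → ℝ} (hP : IsDynamics P) (w : S → A → ℝ) :
    ∑ s', |∑ s, ∑ a, w s a * P s a s'| ≤ ∑ s, ∑ a, |w s a| := by
  calc ∑ s', |∑ s, ∑ a, w s a * P s a s'|
      ≤ ∑ s', ∑ s, ∑ a, |w s a| * P s a s' := by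
        refine Finset.sum_le_sum fun s' _ => (Finset.abs_sum_le_sum_abs _ _).trans ?_
        refine Finset.sum_le_sum fun s _ => (Finset.abs_sum_le_sum_abs _ _).trans ?_
        refine Finset.sum_le_sum fun a _ => ?_
        rw [abs_mul, abs_of_nonneg ((hP s a).1 s')]
    _ = ∑ s, ∑ a, |w s a| := by
        rw [Finset.sum_comm]
        refine Finset.sum_congr rfl fun s _ => ?_
        rw [Finset.sum_comm]
        refine Finset.sum_congr rfl fun a _ => ?_
        rw [← Finset.mul_sum, (hP s a).2, mul_one]

/-- The visitation distributions of two policies are close in `ℓ¹` when the policies are. -/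
lemma sum_abs_visit_sub_le {γ : ℝ} (hγ : 0 < γ) (hγ' : γ < 1)
    {P : S → A → S → ℝ} {π π' : S → A → ℝ} {ρ : S → ℝ}
    (hP : IsDynamics P) (hπ : IsPolicy π) (hπ' : IsPolicy π') (hρ : IsDist ρ) :
    (1 - γ) * ∑ s, |visit γ P π' ρ s - visit γ P π ρ s| ≤
      γ * ∑ s, visit γ P π ρ s * ∑ a, |π' s a - π s a| := by
  set d' := visit γ P π' ρ
  set d := visit γ P π ρ
  have hdiff : ∀ s', d' s' - d s' =
      γ * ∑ s, ∑ a, (d' s * π' s a - d s * π s a) * P s a s' := fun s' => by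
    rw [show d' s' = _ from visit_eq hγ hγ' hP hπ' hρ s',
      show d s' = _ from visit_eq hγ hγ' hP hπ hρ s']
    simp only [step, sub_mul, Finset.sum_sub_distrib]
    ring
  have h1 : ∑ s, |d' s - d s| ≤ γ * ∑ s, ∑ a, |d' s * π' s a - d s * π s a| := by
    calc ∑ s, |d' s - d s|
        = γ * ∑ s', |∑ s, ∑ a, (d' s * π' s a - d s * π s a) * P s a s'| := by
          rw [Finset.mul_sum]
          refine Finset.sum_congr rfl fun s' _ => ?_
          rw [hdiff, abs_mul, abs_of_pos hγ]
      _ ≤ _ := mul_le_mul_of_nonneg_left (sum_abs_sum_mul_le hP _) hγ.le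
  have h2 : ∑ s, ∑ a, |d' s * π' s a - d s * π s a| ≤
      ∑ s, |d' s - d s| + ∑ s, d s * ∑ a, |π' s a - π s a| := by
    rw [← Finset.sum_add_distrib]
    refine Finset.sum_le_sum fun s _ => ?_
    have hs : |d' s - d s| = ∑ a, |d' s - d s| * π' s a := by
      rw [← Finset.mul_sum, (hπ' s).2, mul_one]
    rw [hs, Finset.mul_sum, ← Finset.sum_add_distrib]
    refine Finset.sum_le_sum fun a _ => ?_
    calc |d' s * π' s a - d s * π s a|
        = |(d' s - d s) * π' s a + d s * (π' s a - π s a)| := by congr 1; ring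
      _ ≤ |(d' s - d s) * π' s a| + |d s * (π' s a - π s a)| := abs_add_le _ _
      _ = _ := by
        rw [abs_mul, abs_mul, abs_of_nonneg ((hπ' s).1 a),
          abs_of_nonneg (visit_nonneg hγ hγ' hP hπ hρ s)]
  linarith [mul_le_mul_of_nonneg_left h2 hγ.le]

end Helpers

/-- If `E_{s∼d_{π_n}}[D_TV(π_{n+1}(·|s), π_n(·|s))] ≤ β`, then with
`ε = max_s |E_{a∼π_{n+1}(·|s)}[A^{η_n}(s,a)]|` and
`𝔸_n(π_{n+1}) = E_{s∼d_{π_n}}[E_{a∼π_{n+1}(·|s)}[A^{η_n}(s,a)]]`, one has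
`(1-γ)(J(π_{n+1}) - J(η_n)) ≤ 2εβ/(1-γ) + 𝔸_n(π_{n+1})`. -/
theorem improvement_vs_expert
    {S A : Type*} [Fintype S] [Fintype A] [Nonempty S] [DecidableEq S]
    (γ : ℝ) (P : S → A → S → ℝ) (c : S → A → ℝ) (ρ₀ : S → ℝ)
    (hγ : 0 < γ) (hγ' : γ < 1) (hP : IsDynamics P) (hρ : IsDist ρ₀)
    (hc : ∀ s a, 0 ≤ c s a ∧ c s a ≤ 1)
    (πn πnext ηn : S → A → ℝ)
    (hπn : IsPolicy πn) (hπnext : IsPolicy πnext) (hηn : IsPolicy ηn)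
    (β : ℝ) (hβ : 0 ≤ β)
    (htv : ∑ s, visit γ P πn ρ₀ s * ((∑ a, |πnext s a - πn s a|) / 2) ≤ β) :
    (1 - γ) * (Jf γ P c ρ₀ πnext - Jf γ P c ρ₀ ηn) ≤
      2 * (⨆ s : S, |∑ a, πnext s a * Adv γ P c ηn s a|) * β / (1 - γ) +
        ∑ s, visit γ P πn ρ₀ s * ∑ a, πnext s a * Adv γ P c ηn s a := by
  rw [performance_difference hγ hγ' hP hπnext hρ c ηn]
  set g : S → ℝ := fun s => ∑ a, πnext s a * Adv γ P c ηn s a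
  set ε : ℝ := ⨆ s : S, |g s|
  have hg : ∀ s, |g s| ≤ ε := le_ciSup (Set.finite_range fun s => |g s|).bddAbove
  have hε : 0 ≤ ε := Real.iSup_nonneg fun s => abs_nonneg (g s)
  have hdist := sum_abs_visit_sub_le hγ hγ' hP hπn hπnext hρ
  have htv' : ∑ s, visit γ P πn ρ₀ s * ∑ a, |πnext s a - πn s a| ≤ 2 * β := by
    simp_rw [← mul_div_assoc] at htv
    rw [← Finset.sum_div] at htv
    linarith
  have hD : ∑ s, |visit γ P πnext ρ₀ s - visit γ P πn ρ₀ s| ≤ 2 * β / (1 - γ) := by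
    rw [le_div_iff₀ (by linarith)]
    nlinarith
  have hmain : ∑ s, visit γ P πnext ρ₀ s * g s - ∑ s, visit γ P πn ρ₀ s * g s ≤
      ε * ∑ s, |visit γ P πnext ρ₀ s - visit γ P πn ρ₀ s| := by
    rw [← Finset.sum_sub_distrib, Finset.mul_sum]
    refine Finset.sum_le_sum fun s _ => ?_
    rw [← sub_mul, mul_comm ε]
    refine (le_abs_self _).trans ?_
    rw [abs_mul]
    exact mul_le_mul_of_nonneg_left (hg s) (abs_nonneg _)
  have hεD := mul_le_mul_of_nonneg_left hD hε
  have heq : ε * (2 * β / (1 - γ)) = 2 * ε * β / (1 - γ) := by ring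
  linarith
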